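/- Uniform lower semicontinuity from the right of the polyhedral moving set: Assume (H2) and (H4) for a_i, b_i on [0,T], and let C(t) := {x ∈ ℝ^n : ⟨a_i(t),x⟩ ≤ b_i(t), i = 1,…,m}. Then the set-valued mapping t ↦ C(t) is r-uniformly lower semicontinuous from the right: there exists a family {ξ_r : r ≥ 0} ⊆ W^{1,2}([0,T];ℝ) such that for every r ≥ 0, every s,t ∈ [0,T] with s ≤ t, and every x ∈ ℝ^n with ‖x‖ ≤ r, one has dist(x, C(t)) ≤ dist(x, C(s)) + |ξ_r(t) − ξ_r(s)|. -/

import Mathlib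

open MeasureTheory Set Filter
open scoped RealInnerProductSpace Topology

noncomputable section

abbrev En (n : ℕ) : Type := EuclideanSpace ℝ (Fin n)

/-- Convex normal cone: empty when `x ∉ C`. -/
def normalCone {E : Type*} [NormedAddCommGroup E] [InnerProductSpace ℝ E]
    (C : Set E) (x : E) : Set E :=
  {v | x ∈ C ∧ ∀ y ∈ C, ⟪v, y - x⟫ ≤ 0}

/-- The moving polyhedron `C(a,b)`. -/
def polyhedron {n m : ℕ} (a : Fin m → En n) (b : Fin m → ℝ) : Set (En n) :=
  {x | ∀ i, ⟪a i, x⟫ ≤ b i}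

/-- Active constraint indices. -/
def activeIndex {n m : ℕ} (a : Fin m → En n) (b : Fin m → ℝ) (x : En n) : Set (Fin m) :=
  {i | ⟪a i, x⟫ = b i}

/-- Positive linear independence of `{a i : i ∈ I}`. -/
def PosLinIndepOn {n m : ℕ} (a : Fin m → En n) (I : Set (Fin m)) : Prop :=
  ∀ α : Fin m → ℝ, (∀ i, 0 ≤ α i) → (∀ i, i ∉ I → α i = 0) →
    (∑ i, α i • a i) = 0 → ∀ i ∈ I, α i = 0

/-- Linear independence of `{a i : i ∈ I}`. -/
def LinIndepOnSet {n m : ℕ} (a : Fin m → En n) (I : Set (Fin m)) : Prop :=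
  ∀ α : Fin m → ℝ, (∀ i, i ∉ I → α i = 0) → (∑ i, α i • a i) = 0 → ∀ i, α i = 0

/-- `f ∈ W^{1,2}([0,T];E)` with derivative `f'`: `f'` is in `L²` on `[0,T]` and `f` is the
indefinite (Bochner) integral of `f'`, i.e. `f` is absolutely continuous with a.e. derivative `f'`. -/
def IsW12On {E : Type*} [NormedAddCommGroup E] [NormedSpace ℝ E] [CompleteSpace E]
    (T : ℝ) (f f' : ℝ → E) : Prop :=
  MemLp f' 2 (volume.restrict (Icc (0:ℝ) T)) ∧
  ∀ t ∈ Icc (0:ℝ) T, f t = f 0 + ∫ s in (0:ℝ)..t, f' s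

/-- The projection set `Π(z;Ω)`. -/
def projSet {E : Type*} [NormedAddCommGroup E] (Ω : Set E) (z : E) : Set E :=
  {y | y ∈ Ω ∧ dist z y = Metric.infDist z Ω}

/-- The limiting (Mordukhovich) normal cone. -/
def limNormalCone {E : Type*} [NormedAddCommGroup E] [NormedSpace ℝ E]
    (Ω : Set E) (zb : E) : Set E :=
  {v | ∃ zs vs : ℕ → E, Tendsto zs atTop (𝓝 zb) ∧ Tendsto vs atTop (𝓝 v) ∧
    ∀ k, ∃ lam : ℝ, 0 ≤ lam ∧ ∃ y ∈ projSet Ω (zs k), vs k = lam • (zs k - y)}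

/-- The coderivative of a set-valued mapping. -/
def coderiv {E F : Type*} [NormedAddCommGroup E] [NormedSpace ℝ E]
    [NormedAddCommGroup F] [NormedSpace ℝ F]
    (S : E → Set F) (zb : E) (yb : F) (u : F) : Set E :=
  {v | (v, -u) ∈ limNormalCone {p : E × F | p.2 ∈ S p.1} (zb, yb)}

/-- The limiting subdifferential of an extended-real-valued (here real-valued) function. -/
def limSubdiff {E : Type*} [NormedAddCommGroup E] [NormedSpace ℝ E]
    (h : E → ℝ) (z : E) : Set E :=
  {v | (v, (-1 : ℝ)) ∈ limNormalCone {p : E × ℝ | h p.1 ≤ p.2} (z, h z)}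

/-- The nonpositive orthant `ℝ^m_-`. -/
def negOrthant (m : ℕ) : Set (En m) := {x | ∀ i, x i ≤ 0}

/-- The normal cone mapping `x ↦ N(x;ℝ^m_-)`. -/
def NnegOrthant (m : ℕ) : En m → Set (En m) := fun x => normalCone (negOrthant m) x

/-- `A x`, where `A` is the matrix with rows `a i`. -/
def Aop {n m : ℕ} (a : Fin m → En n) (x : En n) : En m := WithLp.toLp 2 (fun i => ⟪a i, x⟫)

/-- `Aᵀ q`. -/
def ATop {n m : ℕ} (a : Fin m → En n) (q : En m) : En n := ∑ i, q i • a i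

/-- The normal cone mapping `G(x,a,b) = N(x;C(a,b))` as a set-valued map on the product space. -/
def Gmap (n m : ℕ) : (En n × (Fin m → En n) × En m) → Set (En n) :=
  fun z => normalCone (polyhedron z.2.1 (fun i => z.2.2 i)) z.1

/-- The sweeping velocity mapping `F(x,a,b,u) = N(x;C(a,b)) - g(x,u)` as a set-valued map. -/
def FmapSV {n m d : ℕ} (g : En n → En d → En n) :
    (En n × (Fin m → En n) × En m × En d) → Set (En n) :=
  fun z => (fun v => v - g z.1 z.2.2.2) '' normalCone (polyhedron z.2.1 (fun i => z.2.2.1 i)) z.1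


/-- A `W^{1,2}` function with essentially bounded derivative is Lipschitz on `[0,T]`. -/
lemma IsW12On.norm_sub_le {E : Type*} [NormedAddCommGroup E] [NormedSpace ℝ E] [CompleteSpace E]
    {T K : ℝ} {f f' : ℝ → E} (hf : IsW12On T f f')
    (hK : ∀ᵐ t ∂(volume.restrict (Icc (0:ℝ) T)), ‖f' t‖ ≤ K)
    {s t : ℝ} (hs : s ∈ Icc (0:ℝ) T) (ht : t ∈ Icc (0:ℝ) T) :
    ‖f t - f s‖ ≤ K * |t - s| := by
  have hint : IntegrableOn f' (Icc 0 T) := hf.1.integrable one_le_two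
  have hii : ∀ u ∈ Icc (0:ℝ) T, IntervalIntegrable f' volume 0 u := fun u hu =>
    (intervalIntegrable_iff_integrableOn_Ioc_of_le hu.1).2
      (hint.mono_set (Ioc_subset_Icc_self.trans (Icc_subset_Icc_right hu.2)))
  have heq : f t - f s = ∫ u in s..t, f' u := by
    rw [hf.2 t ht, hf.2 s hs, add_sub_add_left_eq_sub,
      intervalIntegral.integral_interval_sub_left (hii t ht) (hii s hs)]
  rw [heq]
  refine intervalIntegral.norm_integral_le_of_norm_le_const_ae ?_
  filter_upwards [(ae_restrict_iff' measurableSet_Icc).1 hK] with u hu hmem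
  refine hu ?_
  rw [uIoc] at hmem
  exact ⟨(le_min hs.1 ht.1).trans hmem.1.le, hmem.2.trans (max_le hs.2 ht.2)⟩

/-- A linear function `t ↦ L * t` is `W^{1,2}` on `[0,T]`. -/
lemma isW12On_const_mul (T L : ℝ) : IsW12On T (fun t => L * t) (fun _ => L) := by
  refine ⟨memLp_const L, fun t _ => ?_⟩
  simp [mul_comm]

lemma isClosed_polyhedron {n m : ℕ} (a : Fin m → En n) (b : Fin m → ℝ) :
    IsClosed (polyhedron a b) := by
  simp only [polyhedron, Set.ofPred_forall]
  exact isClosed_iInter fun i => isClosed_le (by fun_prop) continuous_const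

/-- Slater points with strict slack `c` can be chosen uniformly bounded over a compact set of
parameters. -/
lemma exists_bounded_slater {n m : ℕ} {S : Set ℝ} (hS : IsCompact S)
    {a : ℝ → Fin m → En n} {b : ℝ → Fin m → ℝ} (ha : ContinuousOn a S) (hb : ContinuousOn b S)
    {c : ℝ} (h : ∀ t ∈ S, ∃ x : En n, ∀ i, ⟪a t i, x⟫ - b t i < c) :
    ∃ M : ℝ, 0 ≤ M ∧ ∀ t ∈ S, ∃ x : En n, ‖x‖ ≤ M ∧ ∀ i, ⟪a t i, x⟫ - b t i ≤ c := by
  suffices H : ∃ M : ℝ, 0 ≤ M ∧ ∀ t ∈ S, t ∈ S →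
      ∃ x : En n, ‖x‖ ≤ M ∧ ∀ i, ⟪a t i, x⟫ - b t i ≤ c by
    obtain ⟨M, hM, H⟩ := H
    exact ⟨M, hM, fun t ht => H t ht ht⟩
  refine hS.induction_on (p := fun U => ∃ M : ℝ, 0 ≤ M ∧ ∀ t ∈ U, t ∈ S →
      ∃ x : En n, ‖x‖ ≤ M ∧ ∀ i, ⟪a t i, x⟫ - b t i ≤ c) ⟨0, le_rfl, by simp⟩ ?_ ?_ ?_
  · rintro U V hUV ⟨M, hM, H⟩
    exact ⟨M, hM, fun t ht => H t (hUV ht)⟩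
  · rintro U V ⟨M, hM, H⟩ ⟨N, -, G⟩
    refine ⟨max M N, hM.trans (le_max_left _ _), ?_⟩
    rintro t (ht | ht) htS
    · obtain ⟨x, hx, hxi⟩ := H t ht htS
      exact ⟨x, hx.trans (le_max_left _ _), hxi⟩
    · obtain ⟨x, hx, hxi⟩ := G t ht htS
      exact ⟨x, hx.trans (le_max_right _ _), hxi⟩
  · intro t ht
    obtain ⟨x, hx⟩ := h t ht
    have hev : ∀ᶠ u in 𝓝[S] t, ∀ i, ⟪a u i, x⟫ - b u i < c := by
      refine eventually_all.2 fun i => ?_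
      have hai : ContinuousWithinAt (fun u => a u i) S t := continuousWithinAt_pi.1 (ha t ht) i
      have hbi : ContinuousWithinAt (fun u => b u i) S t := continuousWithinAt_pi.1 (hb t ht) i
      exact ((hai.inner continuousWithinAt_const).sub hbi).eventually_lt_const (hx i)
    exact ⟨_, hev, ‖x‖, norm_nonneg x, fun u hu _ => ⟨x, le_rfl, fun i => (hu i).le⟩⟩

/-- Hoffman-type estimate: if `y` violates the constraints by at most `ε` and `z` satisfies them
with slack `c`, then the polyhedron meets the segment `[y, z]` within `ε / c * ‖z - y‖` of `y`. -/
lemma exists_mem_polyhedron_dist_le {n m : ℕ} {a : Fin m → En n} {b : Fin m → ℝ} {y z : En n}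
    {ε c : ℝ} (hε : 0 ≤ ε) (hc : 0 < c) (hy : ∀ i, ⟪a i, y⟫ - b i ≤ ε)
    (hz : ∀ i, ⟪a i, z⟫ - b i ≤ -c) :
    ∃ w ∈ polyhedron a b, dist y w ≤ ε / c * ‖z - y‖ := by
  have hpos : 0 < ε + c := by linarith
  refine ⟨y + (ε / (ε + c)) • (z - y), fun i => ?_, ?_⟩
  · have hl0 : 0 ≤ ε / (ε + c) := by positivity
    have hl1 : ε / (ε + c) ≤ 1 := (div_le_one hpos).2 (by linarith)
    have hl : (1 - ε / (ε + c)) * ε + ε / (ε + c) * (-c) = 0 := by field_simp; ring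
    rw [inner_add_right, inner_smul_right, inner_sub_right]
    have h1 := mul_le_mul_of_nonneg_left (hy i) (sub_nonneg.2 hl1)
    have h2 := mul_le_mul_of_nonneg_left (hz i) hl0
    linarith
  · rw [dist_self_add_right, norm_smul, Real.norm_of_nonneg (by positivity)]
    gcongr
    linarith

/-- Under (H2) and (H4), the polyhedral moving set `C(t)` is `r`-uniformly
lower semicontinuous from the right. -/
theorem polyhedral_moving_set_uniformly_lsc_right {n m : ℕ} (T : ℝ) (hT : 0 < T)
    (a a' : ℝ → Fin m → En n) (b b' : ℝ → Fin m → ℝ)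
    -- (H2): a, b are W^{1,2} with essentially bounded derivatives
    (ha : IsW12On T a a') (hb : IsW12On T b b')
    (hH2 : ∃ K : ℝ, ∀ᵐ t ∂(volume.restrict (Icc (0:ℝ) T)), ∀ i, ‖a' t i‖ ≤ K ∧ |b' t i| ≤ K)
    -- (H4)
    (hH4a : ∀ i, ∃ v v' : ℝ → ℝ, IsW12On T v v' ∧
      ∀ s ∈ Icc (0:ℝ) T, ∀ t ∈ Icc (0:ℝ) T, ‖a t i - a s i‖ ≤ |v t - v s|)
    (hH4b : ∃ ϑ : ℝ → ℝ, ContinuousOn ϑ (Icc (0:ℝ) T) ∧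
      (∃ c < (0:ℝ), ∀ t ∈ Icc (0:ℝ) T, ϑ t ≤ c) ∧
      ∀ t ∈ Icc (0:ℝ) T, ∃ xs : En n, ∀ i, ⟪a t i, xs⟫ - b t i < ϑ t) :
    ∃ ξ ξ' : ℝ → ℝ → ℝ,
      (∀ r : ℝ, 0 ≤ r → IsW12On T (ξ r) (ξ' r)) ∧
      ∀ r : ℝ, 0 ≤ r → ∀ s ∈ Icc (0:ℝ) T, ∀ t ∈ Icc (0:ℝ) T, s ≤ t →
        ∀ x : En n, ‖x‖ ≤ r →
          Metric.infDist x (polyhedron (a t) (b t)) ≤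
            Metric.infDist x (polyhedron (a s) (b s)) + |ξ r t - ξ r s| := by
  obtain ⟨K₀, hK₀⟩ := hH2
  obtain ⟨ϑ, -, ⟨c, hc, hϑ⟩, hsl⟩ := hH4b
  obtain ⟨K, hK0, hK⟩ : ∃ K : ℝ, 0 ≤ K ∧
      ∀ᵐ t ∂(volume.restrict (Icc (0:ℝ) T)), ∀ i, ‖a' t i‖ ≤ K ∧ |b' t i| ≤ K :=
    ⟨max K₀ 0, le_max_right _ _, hK₀.mono fun t ht i =>
      ⟨(ht i).1.trans (le_max_left _ _), (ht i).2.trans (le_max_left _ _)⟩⟩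
  have hLa : ∀ s ∈ Icc (0:ℝ) T, ∀ t ∈ Icc (0:ℝ) T, ‖a t - a s‖ ≤ K * |t - s| :=
    fun s hs t ht => ha.norm_sub_le
      (hK.mono fun u hu => (pi_norm_le_iff_of_nonneg hK0).2 fun i => (hu i).1) hs ht
  have hLb : ∀ s ∈ Icc (0:ℝ) T, ∀ t ∈ Icc (0:ℝ) T, ‖b t - b s‖ ≤ K * |t - s| :=
    fun s hs t ht => hb.norm_sub_le
      (hK.mono fun u hu => (pi_norm_le_iff_of_nonneg hK0).2 fun i => (hu i).2) hs ht
  have hca : ContinuousOn a (Icc 0 T) := (LipschitzOnWith.of_dist_le_mul (K := ⟨K, hK0⟩)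
    fun t ht s hs => by rw [dist_eq_norm, Real.dist_eq]; exact hLa s hs t ht).continuousOn
  have hcb : ContinuousOn b (Icc 0 T) := (LipschitzOnWith.of_dist_le_mul (K := ⟨K, hK0⟩)
    fun t ht s hs => by rw [dist_eq_norm, Real.dist_eq]; exact hLb s hs t ht).continuousOn
  obtain ⟨M, hM, hslater⟩ := exists_bounded_slater isCompact_Icc hca hcb (c := c) fun t ht =>
    (hsl t ht).imp fun x hx i => (hx i).trans_le (hϑ t ht)
  refine ⟨fun r t => K * (2 * r + M + 1) / (-c) * (2 * r + 2 * M) * t,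
    fun r _ => K * (2 * r + M + 1) / (-c) * (2 * r + 2 * M),
    fun r _ => isW12On_const_mul T _, ?_⟩
  intro r hr s hs t ht _ x hx
  obtain ⟨p, hpM, hp⟩ := hslater s hs
  obtain ⟨q, hqM, hq⟩ := hslater t ht
  have hpmem : p ∈ polyhedron (a s) (b s) := fun i => by linarith [hp i]
  obtain ⟨y, hy, hxy⟩ := (isClosed_polyhedron (a s) (b s)).exists_infDist_eq_dist ⟨p, hpmem⟩ x
  have hynorm : ‖y‖ ≤ 2 * r + M := by
    have h1 : dist x y ≤ dist x p := hxy ▸ Metric.infDist_le_dist_of_mem hpmem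
    rw [dist_eq_norm, dist_eq_norm] at h1
    have h2 := norm_sub_le x p
    have h3 := norm_le_insert x y
    linarith
  have hviol : ∀ i, ⟪a t i, y⟫ - b t i ≤ K * |t - s| * (2 * r + M + 1) := fun i => by
    have h1 : ‖a t i - a s i‖ ≤ K * |t - s| := (norm_le_pi_norm (a t - a s) i).trans (hLa s hs t ht)
    have h2 : |b t i - b s i| ≤ K * |t - s| := (norm_le_pi_norm (b t - b s) i).trans (hLb s hs t ht)
    have h3 : ⟪a t i - a s i, y⟫ ≤ K * |t - s| * (2 * r + M) :=
      (real_inner_le_norm _ _).trans (mul_le_mul h1 hynorm (norm_nonneg _) (by positivity))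
    rw [inner_sub_left] at h3
    have h4 : ⟪a s i, y⟫ ≤ b s i := hy i
    have h5 := (abs_le.1 h2).1
    linarith
  obtain ⟨w, hw, hyw⟩ := exists_mem_polyhedron_dist_le (by positivity) (neg_pos.2 hc) hviol
    (by simpa using hq)
  have hc' : 0 < -c := neg_pos.2 hc
  have hqy : ‖q - y‖ ≤ 2 * r + 2 * M := (norm_sub_le q y).trans (by linarith)
  calc Metric.infDist x (polyhedron (a t) (b t)) ≤ dist x w := Metric.infDist_le_dist_of_mem hw
    _ ≤ dist x y + dist y w := dist_triangle _ _ _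
    _ ≤ Metric.infDist x (polyhedron (a s) (b s)) +
        K * |t - s| * (2 * r + M + 1) / (-c) * (2 * r + 2 * M) := by
      rw [hxy]
      gcongr
      exact hyw.trans (by gcongr)
    _ = _ := by
      rw [← mul_sub, abs_mul, abs_of_nonneg (a := K * (2 * r + M + 1) / (-c) * (2 * r + 2 * M))
        (by positivity)]
      ring
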